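/- arXiv:1002.0345 — 2 statements merged into one kernel-verified Lean document; each statement's English description precedes it below -/
import Mathlib

section
/- For every convex body Q in the plane, the average distance from the Fermat–Weber center of Q to the points of Q is strictly greater than (1/6)·Δ(Q), where Δ(Q) is the diameter of Q. -/
open MeasureTheory Metric Real

lemma fw_quad (A B C u v : ℝ) : ∫ x in u..v, (A * x ^ 2 + B * x + C)
    = A * (v^3 - u^3) / 3 + B * (v^2-u^2)/2 + C * (v-u) := by
  have h : ∀ x ∈ Set.uIcc u v, HasDerivAt (fun x : ℝ => A * x^3/3 + B * x^2/2 + C * x)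
      (A * x ^ 2 + B * x + C) x := by
    intro x _
    have := ((((hasDerivAt_pow 3 x).const_mul A).div_const 3).add
      (((hasDerivAt_pow 2 x).const_mul B).div_const 2)).add ((hasDerivAt_id x).const_mul C)
    refine this.congr_deriv ?_
    norm_num; ring
  rw [intervalIntegral.integral_eq_sub_of_hasDerivAt h
    (Continuous.intervalIntegrable (by fun_prop) _ _)]
  ring

lemma fw_quad' (F : ℝ → ℝ) (A B C u v : ℝ) (huv : u ≤ v)
    (h : ∀ x, u ≤ x → x ≤ v → F x = A * x ^ 2 + B * x + C) : ∫ x in u..v, F x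
    = A * (v^3 - u^3) / 3 + B * (v^2-u^2)/2 + C * (v-u) := by
  rw [← fw_quad]
  apply intervalIntegral.integral_congr
  intro x hx
  rw [Set.uIcc_of_le huv] at hx
  exact h x hx.1 hx.2

lemma fw_tri1 (S t c : ℝ) (hS : 0 ≤ S) (hct : c ≤ t) (ht : t ≤ 1) (hc : 1/6 ≤ c) :
    0 ≤ ∫ x in (0:ℝ)..1, (|x - c| - 1/6) * min (S * (1-t) * x) (S * t * (1 - x)) := by
  have hcont : Continuous (fun x : ℝ => (|x - c| - 1/6) * min (S * (1-t) * x) (S * t * (1 - x))) := by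
    fun_prop
  have hm : ∀ x, x ≤ t → min (S * (1-t) * x) (S * t * (1 - x)) = S * (1-t) * x := by
    intro x hx
    apply min_eq_left
    nlinarith [mul_nonneg hS (sub_nonneg.2 hx)]
  have hm' : ∀ x, t ≤ x → min (S * (1-t) * x) (S * t * (1 - x)) = S * t * (1-x) := by
    intro x hx
    apply min_eq_right
    nlinarith [mul_nonneg hS (sub_nonneg.2 hx)]
  rw [← intervalIntegral.integral_add_adjacent_intervals (b := c) (hcont.intervalIntegrable _ _)
    (hcont.intervalIntegrable _ _),
    ← intervalIntegral.integral_add_adjacent_intervals (a := c) (b := t)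
    (hcont.intervalIntegrable _ _) (hcont.intervalIntegrable _ _)]
  rw [fw_quad' _ (-(S*(1-t))) ((c-1/6)*(S*(1-t))) 0 0 c (by linarith),
    fw_quad' _ (S*(1-t)) ((-c-1/6)*(S*(1-t))) 0 c t hct,
    fw_quad' _ (-(S*t)) (S*t*(1+c+1/6)) (S*t*(-c-1/6)) t 1 ht]
  · have : 0 ≤ 2*t^2+t-6*c*t+4*c^3 := by
      have h1 : 0 ≤ (8*c-1)*(1-2*c)^2 := by
        apply mul_nonneg <;> [linarith; positivity]
      nlinarith [sq_nonneg (4*t + 1 - 6*c)]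
    have h2 := mul_nonneg (mul_nonneg hS (sub_nonneg.2 ht)) this
    nlinarith
  · intro x h1 h2
    rw [hm' x h1, abs_of_nonneg (by linarith)]; ring
  · intro x h1 h2
    rw [hm x h2, abs_of_nonneg (by linarith)]; ring
  · intro x h1 h2
    rw [hm x (by linarith), abs_of_nonpos (by linarith)]; ring

lemma fw_tri (α β c : ℝ) (hα : 0 ≤ α) (hβ : 0 ≤ β) (hc : 1/6 ≤ c) (hc' : c ≤ 5/6) :
    0 ≤ ∫ x in (0:ℝ)..1, (|x - c| - 1/6) * min (α * x) (β * (1 - x)) := by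
  rcases (add_nonneg hα hβ).eq_or_lt with h0 | h0
  · have h1 : α = 0 := by linarith
    have h2 : β = 0 := by linarith
    simp [h1, h2]
  set S := α + β with hS
  obtain ⟨t, ht⟩ : ∃ t, β = S * t := ⟨β / S, by field_simp⟩
  have hα' : α = S * (1 - t) := by linarith
  have ht0 : 0 ≤ t := by by_contra h; nlinarith
  have ht1 : t ≤ 1 := by by_contra h; nlinarith
  rw [hα', ht]
  rcases le_total c t with h | h
  · exact fw_tri1 S t c h0.le h ht1 hc
  · have := fw_tri1 S (1-t) (1-c) h0.le (by linarith) (by linarith) (by linarith)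
    have h3 := intervalIntegral.integral_comp_sub_left (a := 0) (b := 1)
      (fun x : ℝ => (|x - c| - 1/6) * min (S * (1-t) * x) (S * t * (1 - x))) 1
    simp only [sub_zero, sub_self] at h3
    rw [← h3]
    convert this using 4 with x
    · rw [← abs_neg]; ring_nf
    · rw [min_comm]; ring_nf

lemma fw_side (f : ℝ → ℝ) (c : ℝ) (hc : c ≤ 1/6)
    (h0 : ∀ x, 0 ≤ x → x ≤ 1 → 0 ≤ f x)
    (h2 : ∀ x y, 0 ≤ x → x ≤ y → y ≤ 1 → (1 - y) * f x ≤ (1 - x) * f y)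
    (hi : IntervalIntegrable (fun x => (|x - c| - 1/6) * f x) volume 0 1) :
    0 ≤ ∫ x in (0:ℝ)..1, (|x - c| - 1/6) * f x := by
  have h : ∫ x in (0:ℝ)..1, (-(3/2*f (1/3))*x^2 + (4/3*(3/2*f (1/3)))*x + (-(1/3)*(3/2*f (1/3)))) = 0 := by
    rw [fw_quad]; ring
  refine h.symm.le.trans ?_
  apply intervalIntegral.integral_mono_on zero_le_one
    (Continuous.intervalIntegrable (by fun_prop) _ _) hi
  rintro x ⟨hx0, hx1⟩
  have h3 : (x - 1/3) * f x ≤ (|x - c| - 1/6) * f x :=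
    mul_le_mul_of_nonneg_right (by linarith [le_abs_self (x - c)]) (h0 x hx0 hx1)
  refine le_trans ?_ h3
  have : 0 ≤ (x - 1/3) * (f x - (3/2*f (1/3)) * (1-x)) := by
    rcases le_total x (1/3) with h | h
    · have := h2 x (1/3) hx0 h (by norm_num)
      apply mul_nonneg_of_nonpos_of_nonpos <;> linarith
    · have := h2 (1/3) x (by norm_num) h hx1
      apply mul_nonneg <;> linarith
  nlinarith

lemma fw_one (f : ℝ → ℝ) (c : ℝ)
    (h0 : ∀ x, 0 ≤ x → x ≤ 1 → 0 ≤ f x)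
    (h1 : ∀ x y, 0 ≤ x → x ≤ y → y ≤ 1 → x * f y ≤ y * f x)
    (h2 : ∀ x y, 0 ≤ x → x ≤ y → y ≤ 1 → (1 - y) * f x ≤ (1 - x) * f y)
    (hi : IntervalIntegrable (fun x => (|x - c| - 1/6) * f x) volume 0 1) :
    0 ≤ ∫ x in (0:ℝ)..1, (|x - c| - 1/6) * f x := by
  rcases le_or_gt c (1/6) with hc | hc
  · exact fw_side f c hc h0 h2 hi
  rcases le_or_gt (5/6) c with hc' | hc'
  · have e : (fun x => (|x - (1 - c)| - 1/6) * f (1 - x)) =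
        fun x => (fun x => (|x - c| - 1/6) * f x) (1 - x) := by
      funext x
      have : |x - (1-c)| = |1 - x - c| := by rw [← abs_neg]; ring_nf
      simp only [this]
    have := fw_side (fun x => f (1 - x)) (1 - c) (by linarith)
      (fun x hx hx' => h0 _ (by linarith) (by linarith))
      (fun x y hx hxy hy => by
        have := h1 (1-y) (1-x) (by linarith) (by linarith) (by linarith)
        simpa using this)
      (by
        rw [e]
        have := (hi.comp_sub_left 1).symm
        simpa using this)
    rw [e, intervalIntegral.integral_comp_sub_left (fun x => (|x - c| - 1/6) * f x) 1] at this
    simpa using this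
  · have ha : 0 < c - 1/6 := by linarith
    have hb : 0 < 1 - (c + 1/6) := by linarith
    have fa := h0 (c-1/6) (by linarith) (by linarith)
    have fb := h0 (c+1/6) (by linarith) (by linarith)
    obtain ⟨α, hα⟩ : ∃ α, f (c-1/6) = α * (c-1/6) := ⟨f (c-1/6) / (c-1/6), (div_mul_cancel₀ _ ha.ne').symm⟩
    obtain ⟨β, hβ⟩ : ∃ β, f (c+1/6) = β * (1 - (c+1/6)) :=
      ⟨f (c+1/6) / (1 - (c+1/6)), (div_mul_cancel₀ _ hb.ne').symm⟩
    have hα0 : 0 ≤ α := by by_contra h; nlinarith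
    have hβ0 : 0 ≤ β := by by_contra h; nlinarith
    refine (fw_tri α β c hα0 hβ0 hc.le hc'.le).trans ?_
    apply intervalIntegral.integral_mono_on zero_le_one
      (Continuous.intervalIntegrable (by fun_prop) _ _) hi
    rintro x ⟨hx0, hx1⟩
    rcases le_total x (c-1/6) with h | h
    · apply mul_le_mul_of_nonneg_left
      · refine (min_le_left _ _).trans ?_
        have := h1 x (c-1/6) hx0 h (by linarith)
        rw [hα] at this
        refine le_of_mul_le_mul_left ?_ ha
        linarith
      · rw [abs_of_nonpos (by linarith)]; linarith
    rcases le_total (c+1/6) x with h' | h'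
    · apply mul_le_mul_of_nonneg_left
      · refine (min_le_right _ _).trans ?_
        have := h2 (c+1/6) x (by linarith) h' hx1
        rw [hβ] at this
        refine le_of_mul_le_mul_left ?_ hb
        linarith
      · rw [abs_of_nonneg (by linarith)]; linarith
    · apply mul_le_mul_of_nonpos_left
      · apply le_min
        · have := h1 (c-1/6) x (by linarith) h hx1
          rw [hα] at this
          refine le_of_mul_le_mul_left ?_ ha
          linarith
        · have := h2 x (c+1/6) hx0 h' (by linarith)
          rw [hβ] at this
          refine le_of_mul_le_mul_left ?_ hb
          linarith
      · have : |x - c| ≤ 1/6 := abs_le.2 ⟨by linarith, by linarith⟩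
        linarith

lemma fw_slice {K : Set (ℝ × ℝ)} (hK : IsCompact K) (hKc : Convex ℝ K) (x y s t : ℝ)
    (hs : 0 ≤ s) (ht : 0 ≤ t) (hst : s + t = 1)
    (hx : ∃ v, (x, v) ∈ K) (hy : ∃ v, (y, v) ∈ K) :
    s * volume.real (Prod.mk x ⁻¹' K) + t * volume.real (Prod.mk y ⁻¹' K)
      ≤ volume.real (Prod.mk (s * x + t * y) ⁻¹' K) := by
  have hcpt : ∀ x : ℝ, IsCompact (Prod.mk x ⁻¹' K) := by
    intro x
    have h1 : IsClosed (Prod.mk x ⁻¹' K) := hK.isClosed.preimage (by fun_prop)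
    refine (hK.image continuous_snd).of_isClosed_subset h1 ?_
    intro v hv
    exact ⟨(x, v), hv, rfl⟩
  have hconv : ∀ x : ℝ, Convex ℝ (Prod.mk x ⁻¹' K) := by
    intro x u hu v hv a b ha hb hab
    have := hKc hu hv ha hb hab
    have e : a • (x, u) + b • (x, v) = (x, a • u + b • v) := by
      ext <;> simp
      rw [← add_mul, hab, one_mul]
    rw [e] at this
    exact this
  have hIcc : ∀ x : ℝ, (∃ v, (x, v) ∈ K) → ∃ l u, l ≤ u ∧ Prod.mk x ⁻¹' K = Set.Icc l u := by
    rintro x ⟨v, hv⟩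
    have hne : (Prod.mk x ⁻¹' K).Nonempty := ⟨v, hv⟩
    have h := eq_Icc_of_connected_compact ⟨hne, (hconv x).isPreconnected⟩ (hcpt x)
    refine ⟨_, _, ?_, h⟩
    rw [h] at hne
    exact Set.nonempty_Icc.1 hne
  obtain ⟨l1, u1, h1, e1⟩ := hIcc x hx
  obtain ⟨l2, u2, h2, e2⟩ := hIcc y hy
  have hl1 : (x, l1) ∈ K := by
    change l1 ∈ Prod.mk x ⁻¹' K; rw [e1]; exact ⟨le_rfl, h1⟩
  have hu1 : (x, u1) ∈ K := by
    change u1 ∈ Prod.mk x ⁻¹' K; rw [e1]; exact ⟨h1, le_rfl⟩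
  have hl2 : (y, l2) ∈ K := by
    change l2 ∈ Prod.mk y ⁻¹' K; rw [e2]; exact ⟨le_rfl, h2⟩
  have hu2 : (y, u2) ∈ K := by
    change u2 ∈ Prod.mk y ⁻¹' K; rw [e2]; exact ⟨h2, le_rfl⟩
  have hl : s * l1 + t * l2 ∈ Prod.mk (s * x + t * y) ⁻¹' K := by
    simpa using hKc hl1 hl2 hs ht hst
  have hu : s * u1 + t * u2 ∈ Prod.mk (s * x + t * y) ⁻¹' K := by
    simpa using hKc hu1 hu2 hs ht hst
  have hsub : Set.Icc (s * l1 + t * l2) (s * u1 + t * u2) ⊆ Prod.mk (s * x + t * y) ⁻¹' K :=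
    (hconv _).ordConnected.out hl hu
  have hm := measureReal_mono (μ := volume) hsub (hcpt _).measure_lt_top.ne
  rw [Real.volume_real_Icc_of_le (by gcongr)] at hm
  rw [e1, e2, Real.volume_real_Icc_of_le h1, Real.volume_real_Icc_of_le h2]
  linarith

lemma fw_plane {K : Set (ℝ × ℝ)} (hK : IsCompact K) (hKc : Convex ℝ K) (a b c : ℝ) (hab : a < b)
    (hin : ∀ z ∈ K, a ≤ z.1 ∧ z.1 ≤ b) (ha : ∃ v, (a, v) ∈ K) (hb : ∃ v, (b, v) ∈ K) :
    0 ≤ ∫ z in K, (|z.1 - c| - (b - a) / 6) := by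
  set f : ℝ → ℝ := fun x => volume.real (Prod.mk x ⁻¹' K) with hf
  set D := b - a with hD
  have hD0 : 0 < D := by linarith
  have hint : Integrable (K.indicator fun z : ℝ × ℝ => (|z.1 - c| - D / 6)) (volume.prod volume) := by
    rw [integrable_indicator_iff hK.measurableSet]
    exact ContinuousOn.integrableOn_compact hK (by fun_prop)
  have hinner : ∀ x : ℝ, ∫ y : ℝ, K.indicator (fun z : ℝ × ℝ => (|z.1 - c| - D / 6)) (x, y)
      = (|x - c| - D / 6) * f x := by
    intro x
    have : (fun y : ℝ => K.indicator (fun z : ℝ × ℝ => (|z.1 - c| - D / 6)) (x, y))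
        = (Prod.mk x ⁻¹' K).indicator (fun _ => (|x - c| - D / 6)) := by
      funext y; rfl
    rw [this, integral_indicator (hK.measurableSet.preimage (by fun_prop))]
    simp [hf, mul_comm]
  have hint1 : Integrable (fun x => (|x - c| - D / 6) * f x) := by
    have := hint.integral_prod_left
    simpa only [hinner] using this
  rw [← integral_indicator hK.measurableSet, Measure.volume_eq_prod, integral_prod _ hint]
  simp only [hinner]
  have hout : ∀ x, x ∉ Set.Icc a b → (|x - c| - D / 6) * f x = 0 := by
    intro x hx
    have : Prod.mk x ⁻¹' K = ∅ := by
      ext v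
      simp only [Set.mem_preimage, Set.mem_empty_iff_false, iff_false]
      intro h
      exact hx (hin _ h)
    simp [hf, this]
  rw [← setIntegral_eq_integral_of_forall_compl_eq_zero hout, integral_Icc_eq_integral_Ioc,
    ← intervalIntegral.integral_of_le hab.le]
  have hne : ∀ x, 0 ≤ x → x ≤ 1 → ∃ v, (a + D * x, v) ∈ K := by
    intro x h0 h1
    obtain ⟨v, hv⟩ := ha
    obtain ⟨w, hw⟩ := hb
    have := hKc hv hw (sub_nonneg.2 h1) h0 (by ring)
    refine ⟨(1 - x) * v + x * w, ?_⟩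
    convert this using 1
    ext <;> simp
    rw [hD]; ring
  have hconc : ∀ x y s t, 0 ≤ x → x ≤ 1 → 0 ≤ y → y ≤ 1 → 0 ≤ s → 0 ≤ t → s + t = 1 →
      s * f (a + D * x) + t * f (a + D * y) ≤ f (a + D * (s * x + t * y)) := by
    intro x y s t hx hx' hy hy' hs ht hst
    have := fw_slice hK hKc _ _ s t hs ht hst (hne x hx hx') (hne y hy hy')
    have e : s * (a + D * x) + t * (a + D * y) = a + D * (s * x + t * y) := by
      have : s = 1 - t := by linarith
      rw [this]; ring
    rw [e] at this
    exact this
  have hf0 : ∀ x, 0 ≤ f x := fun x => measureReal_nonneg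
  have e : ∀ x, (|a + D * x - c| - D / 6) * f (a + D * x)
      = D * ((|x - (c - a) / D| - 1/6) * f (a + D * x)) := by
    intro x
    have : a + D * x - c = D * (x - (c - a) / D) := by field_simp; ring
    rw [this, abs_mul, abs_of_pos hD0]; ring
  have hint2 : Integrable (fun x => (|x - (c - a) / D| - 1/6) * f (a + D * x)) := by
    have h1 := ((hint1.comp_add_left a).comp_mul_left' hD0.ne').const_mul D⁻¹
    refine h1.congr (Filter.Eventually.of_forall fun x => ?_)
    simp only [e]
    field_simp
  have key := fw_one (fun x => f (a + D * x)) ((c - a) / D) (fun x _ _ => hf0 _)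
    (by
      intro x y hx hxy hy
      rcases (hx.trans hxy).eq_or_lt with h | h
      · have : x = 0 := by linarith
        simp [this, ← h]
      · have := hconc y 0 (x / y) (1 - x / y) h.le hy le_rfl zero_le_one (by positivity)
          (sub_nonneg.2 ((div_le_one h).2 hxy)) (by ring)
        have e1 : x / y * y + (1 - x / y) * 0 = x := by field_simp; ring
        rw [e1] at this
        have h3 : x / y * f (a + D * y) ≤ f (a + D * x) := by
          nlinarith [mul_nonneg (sub_nonneg.2 ((div_le_one h).2 hxy)) (hf0 (a + D * 0))]
        rw [div_mul_eq_mul_div, div_le_iff₀ h] at h3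
        linarith)
    (by
      intro x y hx hxy hy
      rcases (hxy.trans hy).eq_or_lt with h | h
      · have : y = 1 := by linarith
        simp [this, h]
      · have h' : 0 < 1 - x := by linarith
        have hle : (1 - y) / (1 - x) ≤ 1 := (div_le_one h').2 (by linarith)
        have := hconc x 1 ((1 - y) / (1 - x)) (1 - (1 - y) / (1 - x)) hx h.le zero_le_one le_rfl
          (div_nonneg (by linarith) h'.le) (sub_nonneg.2 hle) (by ring)
        have e1 : (1 - y) / (1 - x) * x + (1 - (1 - y) / (1 - x)) * 1 = y := by
          field_simp; ring
        rw [e1] at this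
        have h3 : (1 - y) / (1 - x) * f (a + D * x) ≤ f (a + D * y) := by
          nlinarith [mul_nonneg (sub_nonneg.2 hle) (hf0 (a + D * 1))]
        rw [div_mul_eq_mul_div, div_le_iff₀ h'] at h3
        linarith)
    hint2.intervalIntegrable
  have h4 := intervalIntegral.integral_comp_add_mul (a := 0) (b := 1)
    (fun x => (|x - c| - D / 6) * f x) hD0.ne' a
  simp only [e, intervalIntegral.integral_const_mul, mul_zero, add_zero, mul_one, smul_eq_mul] at h4
  have h5 : a + D = b := by rw [hD]; ring
  rw [h5] at h4
  have h6 : ∫ x in a..b, (|x - c| - D / 6) * f x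
      = D * (D * ∫ x in (0:ℝ)..1, (|x - (c - a) / D| - 1/6) * f (a + D * x)) := by
    rw [h4, mul_inv_cancel_left₀ hD0.ne']
  rw [h6]
  positivity

set_option maxHeartbeats 1000000 in
theorem fermat_weber_lower_bound (Q : Set (EuclideanSpace ℝ (Fin 2)))
    (hQc : IsCompact Q) (hQconv : Convex ℝ Q) (hQint : (interior Q).Nonempty) :
    (1 : ℝ) / 6 * Metric.diam Q <
      ⨅ p : EuclideanSpace ℝ (Fin 2), (∫ q in Q, dist p q) / (volume Q).toReal := by
  have hvol : 0 < (volume Q).toReal :=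
    ENNReal.toReal_pos (Measure.measure_pos_of_nonempty_interior _ hQint).ne' hQc.measure_lt_top.ne
  have hQne : Q.Nonempty := hQint.mono interior_subset
  -- diameter attained
  obtain ⟨⟨A, B⟩, ⟨hA, hB⟩, hmax⟩ := (hQc.prod hQc).exists_isMaxOn (hQne.prod hQne)
    (f := fun z => dist z.1 z.2) (by fun_prop)
  have hle : ∀ x ∈ Q, ∀ y ∈ Q, dist x y ≤ dist A B := by
    intro x hx y hy
    exact isMaxOn_iff.1 hmax (x, y) (Set.mk_mem_prod hx hy)
  have hdiam : diam Q = dist A B :=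
    le_antisymm (diam_le_of_forall_dist_le dist_nonneg hle)
      (dist_le_diam_of_mem hQc.isBounded hA hB)
  have hAB : A ≠ B := by
    intro h
    have hsub : Q.Subsingleton := by
      intro x hx y hy
      have := hle x hx y hy
      rw [h, dist_self] at this
      exact dist_le_zero.1 this
    have h0 : volume Q = 0 := hsub.measure_zero volume
    rw [h0] at hvol
    simp at hvol
  set D := dist A B with hD
  have hD0 : 0 < D := dist_pos.2 hAB
  -- orthonormal basis
  obtain ⟨e, he⟩ : ∃ e : OrthonormalBasis (Fin 2) ℝ (EuclideanSpace ℝ (Fin 2)),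
      ∀ i ∈ ({0} : Set (Fin 2)), e i = D⁻¹ • (B - A) := by
    apply Orthonormal.exists_orthonormalBasis_extension_of_card_eq (v := fun _ => D⁻¹ • (B - A))
    · simp
      rw [norm_smul, ← dist_eq_norm, dist_comm B A, norm_inv, Real.norm_of_nonneg hD0.le]
      exact inv_mul_cancel₀ hD0.ne'
    · simp
  have he0 := he 0 rfl
  have hnorm : ∀ v, (inner ℝ (e 0) v) ^ 2 + (inner ℝ (e 1) v) ^ 2 = ‖v‖ ^ 2 := by
    intro v
    simpa [Fin.sum_univ_two] using e.sum_sq_norm_inner_right v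
  have hle0 : ∀ v, |inner ℝ (e 0) v| ≤ ‖v‖ := by
    intro v
    apply abs_le_of_sq_le_sq _ (norm_nonneg _)
    nlinarith [hnorm v, sq_nonneg (inner ℝ (e 1) v)]
  have hlt0 : ∀ v, inner ℝ (e 1) v ≠ 0 → |inner ℝ (e 0) v| < ‖v‖ := by
    intro v hv
    apply abs_lt_of_sq_lt_sq _ (norm_nonneg _)
    have := sq_pos_of_ne_zero hv
    linarith [hnorm v]
  -- the map
  set Φ : EuclideanSpace ℝ (Fin 2) →ₗ[ℝ] ℝ × ℝ :=
    (innerₛₗ ℝ (e 0)).prod (innerₛₗ ℝ (e 1)) with hΦ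
  have hΦ1 : ∀ q, Φ q = (inner ℝ (e 0) q, inner ℝ (e 1) q) := fun q => rfl
  have hΦeq : ⇑Φ = ⇑((e.measurableEquiv.trans (MeasurableEquiv.toLp 2 (Fin 2 → ℝ)).symm).trans
      MeasurableEquiv.finTwoArrow) := by
    funext q
    rw [hΦ1, ← e.repr_apply_apply, ← e.repr_apply_apply]
    rfl
  have hΦemb : MeasurableEmbedding Φ := by
    rw [hΦeq]; exact MeasurableEquiv.measurableEmbedding _
  have hΦmp : MeasurePreserving Φ volume volume := by
    rw [hΦeq]
    exact (volume_preserving_finTwoArrow ℝ).comp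
      ((EuclideanSpace.volume_preserving_symm_measurableEquiv_toLp _).comp
        e.measurePreserving_measurableEquiv)
  have hΦcont : Continuous Φ := Φ.continuous_of_finiteDimensional
  have hBA : inner ℝ (e 0) (B - A) = D := by
    have h1 : B - A = D • e 0 := by rw [he0, smul_inv_smul₀ hD0.ne']
    rw [h1, inner_smul_right, real_inner_self_eq_norm_sq, e.norm_eq_one]; ring
  have hab : inner ℝ (e 0) B - inner ℝ (e 0) A = D := by rw [← inner_sub_right, hBA]
  have hmain : ∀ p : EuclideanSpace ℝ (Fin 2),
      0 ≤ ∫ q in Q, (|inner ℝ (e 0) q - inner ℝ (e 0) p| - D / 6) := by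
    intro p
    have := fw_plane (hQc.image hΦcont) (hQconv.linear_image Φ) (inner ℝ (e 0) A)
      (inner ℝ (e 0) B) (inner ℝ (e 0) p) (by linarith)
      (by
        rintro _ ⟨q, hq, rfl⟩
        rw [hΦ1]
        have h1 := (le_abs_self _).trans (hle0 (q - A))
        have h2 := (le_abs_self _).trans (hle0 (B - q))
        rw [← dist_eq_norm] at h1 h2
        have h3 := hle q hq A hA
        have h4 := hle B hB q hq
        rw [inner_sub_right] at h1 h2
        constructor <;> simp only <;> linarith)
      ⟨_, A, hA, hΦ1 A⟩ ⟨_, B, hB, hΦ1 B⟩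
    rw [hΦmp.setIntegral_image_emb hΦemb, hab] at this
    exact this
  have hcont0 : Continuous fun q : EuclideanSpace ℝ (Fin 2) => inner ℝ (e 0) q := by fun_prop
  have hstrict : ∀ p : EuclideanSpace ℝ (Fin 2),
      1 / 6 * D < (∫ q in Q, dist p q) / (volume Q).toReal := by
    intro p
    set g : EuclideanSpace ℝ (Fin 2) → ℝ :=
      fun q => dist p q - |inner ℝ (e 0) q - inner ℝ (e 0) p| with hg
    have hgc : Continuous g := by fun_prop
    have hgn : ∀ q, g q = ‖q - p‖ - |inner ℝ (e 0) (q - p)| := by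
      intro q; simp only [hg]; rw [dist_comm, dist_eq_norm, inner_sub_right]
    have hg0 : ∀ q, 0 ≤ g q := fun q => by rw [hgn]; linarith [hle0 (q - p)]
    have hU : (interior Q ∩ {q | 0 < g q}).Nonempty := by
      obtain ⟨q, hq⟩ := hQint
      by_cases h : inner ℝ (e 1) (q - p) = 0
      · have hc : Continuous fun s : ℝ => q + s • e 1 := by fun_prop
        have hev : ∀ᶠ s in nhds (0:ℝ), q + s • e 1 ∈ interior Q :=
          hc.continuousAt.eventually_mem (isOpen_interior.mem_nhds (by simpa using hq))
        obtain ⟨s, hs, hs0⟩ := ((hev.filter_mono nhdsWithin_le_nhds).and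
          (self_mem_nhdsWithin : {(0:ℝ)}ᶜ ∈ nhdsWithin (0:ℝ) {0}ᶜ)).exists
        refine ⟨_, hs, ?_⟩
        have e2 : q + s • e 1 - p = (q - p) + s • e 1 := by abel
        have : inner ℝ (e 1) (q + s • e 1 - p) ≠ 0 := by
          rw [e2, inner_add_right, h, inner_smul_right, real_inner_self_eq_norm_sq, e.norm_eq_one]
          simpa using hs0
        have := hlt0 _ this
        simp only [Set.mem_ofPred_eq, hgn]
        linarith
      · refine ⟨q, hq, ?_⟩
        have := hlt0 _ h
        simp only [Set.mem_ofPred_eq, hgn]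
        linarith
    have hUo : IsOpen (interior Q ∩ {q | 0 < g q}) :=
      isOpen_interior.inter (isOpen_lt continuous_const hgc)
    have hpos : 0 < ∫ q in Q, g q := by
      rw [setIntegral_pos_iff_support_of_nonneg_ae (Filter.Eventually.of_forall hg0)
        (hgc.continuousOn.integrableOn_compact hQc)]
      refine (hUo.measure_pos volume hU).trans_le (measure_mono ?_)
      rintro q ⟨h1, h2⟩
      exact ⟨ne_of_gt h2, interior_subset h1⟩
    have i1 : IntegrableOn (fun q : EuclideanSpace ℝ (Fin 2) =>
        |inner ℝ (e 0) q - inner ℝ (e 0) p|) Q volume :=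
      ContinuousOn.integrableOn_compact hQc (by fun_prop)
    have i2 : IntegrableOn (fun q : EuclideanSpace ℝ (Fin 2) => dist p q) Q volume :=
      ContinuousOn.integrableOn_compact hQc (by fun_prop)
    have i3 : IntegrableOn (fun _ : EuclideanSpace ℝ (Fin 2) => D / 6) Q volume :=
      ContinuousOn.integrableOn_compact hQc (by fun_prop)
    have hm := hmain p
    rw [integral_sub i1 i3] at hm
    simp only [hg] at hpos
    rw [integral_sub i2 i1] at hpos
    rw [setIntegral_const, smul_eq_mul, measureReal_def] at hm
    rw [lt_div_iff₀ hvol]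
    linarith
  -- the infimum is attained
  have hFc : Continuous fun p : EuclideanSpace ℝ (Fin 2) =>
      (∫ q in Q, dist p q) / (volume Q).toReal := by
    refine Continuous.div_const ?_ _
    exact continuous_parametric_integral_of_continuous
      (f := fun p q : EuclideanSpace ℝ (Fin 2) => dist p q) continuous_dist hQc
  have hFt : Filter.Tendsto (fun p : EuclideanSpace ℝ (Fin 2) =>
      (∫ q in Q, dist p q) / (volume Q).toReal) (Filter.cocompact _) Filter.atTop := by
    refine Filter.tendsto_atTop_mono (f := fun p => dist p A - D) ?_
      (Filter.tendsto_atTop_add_const_right _ (-D) (tendsto_dist_right_cocompact_atTop A))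
    intro p
    rw [le_div_iff₀ hvol]
    have i2 : IntegrableOn (fun q : EuclideanSpace ℝ (Fin 2) => dist p q) Q volume :=
      ContinuousOn.integrableOn_compact hQc (by fun_prop)
    have i3 : IntegrableOn (fun _ : EuclideanSpace ℝ (Fin 2) => dist p A - D) Q volume :=
      ContinuousOn.integrableOn_compact hQc (by fun_prop)
    have := setIntegral_mono_on i3 i2 hQc.measurableSet (by
      intro q hq
      have h1 := dist_triangle p q A
      have h2 := hle q hq A hA
      linarith)
    rw [setIntegral_const, smul_eq_mul, measureReal_def] at this
    linarith
  obtain ⟨p, hp⟩ := hFc.exists_forall_le hFt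
  rw [hdiam]
  exact (hstrict p).trans_le (le_ciInf hp)
end

section
/- For every convex body Q in the plane, μ*_Q ≤ (2(4−√3)/13)·Δ(Q), where 2(4−√3)/13 < 0.3490. -/
open MeasureTheory Metric Real

local notation "E2" => EuclideanSpace ℝ (Fin 2)

lemma fw_mono {k x y : ℝ} (hk : 0 < k) (hx : 2*k/3 ≤ x) (hxy : x ≤ y) :
    x^3 - k*x^2 ≤ y^3 - k*y^2 := by
  have h1 : 0 ≤ y^2 + x*y + x^2 - k*(x+y) := by
    nlinarith [sq_nonneg (x-y), mul_nonneg (show 0 ≤ x+y by linarith) (show 0 ≤ x+y-4*k/3 by linarith)]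
  nlinarith [mul_nonneg (sub_nonneg.2 hxy) h1]

lemma fw_anti {k x y : ℝ} (hx : 0 ≤ x) (hxy : x ≤ y) (hy : y ≤ 2*k/3) :
    y^3 - k*y^2 ≤ x^3 - k*x^2 := by
  have h1 : 0 ≤ k*(x+y) - (y^2 + x*y + x^2) := by
    nlinarith [mul_nonneg hx (show 0 ≤ 2*k/3 - x by linarith), mul_nonneg hx (show 0 ≤ 2*k/3 - y by linarith),
      mul_nonneg (show 0 ≤ y by linarith) (show 0 ≤ 2*k/3 - x by linarith),
      mul_nonneg (show 0 ≤ y by linarith) (show 0 ≤ 2*k/3 - y by linarith)]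
  nlinarith [mul_nonneg (sub_nonneg.2 hxy) h1]

lemma fw_poly {t s : ℝ} (h1 : 1 ≤ t) (hs : 0 ≤ s) (h3 : s^2 = 3) (h2 : t ≤ s) :
    t*(t^4+3) ≤ 2.093*(t^4+1) := by
  have hs2 : s ≤ 1.7321 := by nlinarith
  have ht : t ≤ 1.7321 := by linarith
  rcases le_total t 1.4 with h | h
  · have e : 0 ≤ (t-1)*(1.4-t) := mul_nonneg (by linarith) (by linarith)
    nlinarith [mul_nonneg e (by linarith : 0 ≤ t), mul_nonneg e (by positivity : 0 ≤ t^2), mul_nonneg e (by positivity : 0 ≤ t^3)]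
  · have e : 0 ≤ (t-1.4)*(1.7321-t) := mul_nonneg (by linarith) (by linarith)
    nlinarith [mul_nonneg e (by linarith : 0 ≤ t), mul_nonneg e (by positivity : 0 ≤ t^2), mul_nonneg e (by positivity : 0 ≤ t^3)]

lemma fw_Rh {R h s k : ℝ} (hs : 0 ≤ s) (h3 : s^2 = 3) (hk : k = 3*(4-s)/13) (hh : 0 ≤ h)
    (hR : 1/2 ≤ R) (hR3 : R^2 ≤ 1/3) (hRh : h^2 = R^2 - 1/4) :
    R^3 - k*R^2 + (h^3 - k*h^2) ≤ 0 := by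
  have hs2 : s ≤ 1.7321 := by nlinarith
  have hkb : 2.093/4 ≤ k := by rw [hk]; linarith
  have key : (2*(R+h))*((2*(R+h))^4+3) ≤ 2.093*((2*(R+h))^4+1) := by
    apply fw_poly (s := s) (by linarith) hs h3
    have hh2 : h^2 ≤ 1/12 := by linarith
    have : R ≤ s/3 := by
      apply abs_le_of_sq_le_sq' _ (by positivity) |>.2
      nlinarith
    have : h ≤ s/6 := by
      apply abs_le_of_sq_le_sq' _ (by positivity) |>.2
      nlinarith
    linarith
  set t := 2*(R+h) with ht
  have htp : 0 < t := by linarith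
  have e1 : t*(R-h) = 1/2 := by rw [ht]; nlinarith
  have e2 : R = (t + 1/t)/4 := by field_simp; nlinarith
  have e3 : h = (t - 1/t)/4 := by field_simp; nlinarith
  have : R^3 + h^3 ≤ 2.093/4*(R^2+h^2) := by
    have : 2.093/4*(R^2+h^2) - (R^3+h^3) = (2.093*(t^4+1) - t*(t^4+3))/(32*t^2) := by
      rw [e2, e3]; field_simp; ring
    have h0 : 0 ≤ (2.093*(t^4+1) - t*(t^4+3))/(32*t^2) := div_nonneg (by linarith) (by positivity)
    linarith
  nlinarith [sq_nonneg R, sq_nonneg h]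

lemma fw_ineq1 {R h s k a b : ℝ} (hs : 0 ≤ s) (h3 : s^2 = 3) (hk : k = 3*(4-s)/13)
    (hb0 : 0 ≤ b) (hba : b ≤ a) (haR : a ≤ R) (hab : a + b ≤ 1)
    (H : 1/2 < R → 0 ≤ h ∧ h^2 = R^2 - 1/4 ∧ R^2 ≤ 1/3 ∧ h ≤ b) :
    a^3 - k*a^2 + (b^3 - k*b^2) ≤ 0 := by
  have hs2 : s ≤ 1.7321 := by nlinarith
  have hs1 : 1.732 ≤ s := by nlinarith
  have hkb : 0.523 ≤ k := by rw [hk]; linarith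
  have hkb2 : k ≤ 0.5236 := by rw [hk]; linarith
  rcases le_or_gt a k with hak | hak
  · nlinarith [mul_nonneg (sq_nonneg a) (sub_nonneg.2 hak), mul_nonneg (sq_nonneg b) (sub_nonneg.2 (hba.trans hak))]
  obtain ⟨hh, hRh, hR3, hhb⟩ := H (by linarith)
  have hRs : R ≤ s/3 := by
    apply abs_le_of_sq_le_sq' _ (by positivity) |>.2
    nlinarith
  rcases le_or_gt b (2*k/3) with hbk | hbk
  · have := fw_Rh hs h3 hk hh (by linarith) hR3 hRh
    have := fw_mono (k := k) (x := a) (y := R) (by linarith) (by linarith) haR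
    have := fw_anti hh hhb hbk
    linarith
  rcases le_or_gt b (1 - s/3) with hb | hb
  · have := fw_mono (k := k) (x := a) (y := s/3) (by linarith) (by linarith) (by linarith)
    have := fw_mono (k := k) (by linarith) hbk.le hb
    have : (s/3)^3 - k*(s/3)^2 + ((1-s/3)^3 - k*(1-s/3)^2) = 0 := by
      rw [hk]; ring_nf; 
      have : s^3 = 3*s := by rw [pow_succ, h3]
      rw [this, h3]; ring
    linarith
  · have := fw_mono (k := k) (x := a) (y := 1-b) (by linarith) (by linarith) (by linarith)
    have hp : (s-1)/3 ≤ b*(1-b) := by nlinarith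
    have : (1-b)^3 - k*(1-b)^2 + (b^3 - k*b^2) ≤ 0 := by
      have e : (1-b)^3 - k*(1-b)^2 + (b^3 - k*b^2) = (1-k) - (3-2*k)*(b*(1-b)) := by ring
      have e2 : (3-2*k)*((s-1)/3) = 1-k := by rw [hk]; nlinarith
      have := mul_le_mul_of_nonneg_left hp (by linarith : 0 ≤ 3-2*k)
      linarith
    linarith

lemma fw_ineq {D R h a b : ℝ} (hD : 0 < D)
    (ha0 : 0 ≤ a) (hb0 : 0 ≤ b) (haR : a ≤ R) (hbR : b ≤ R) (hab : a + b ≤ D)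
    (H : D/2 < R → 0 ≤ h ∧ h^2 = R^2 - D^2/4 ∧ R^2 ≤ D^2/3 ∧ h ≤ a ∧ h ≤ b) :
    (a^3/3 - (2 * (4 - √3) / 13 * D) * a^2/2) + (b^3/3 - (2 * (4 - √3) / 13 * D) * b^2/2) ≤ 0 := by
  wlog hba : b ≤ a generalizing a b
  · have := this hb0 ha0 hbR haR (by linarith) (fun h => by grind) (by linarith)
    linarith
  have := fw_ineq1 (R := R/D) (h := h/D) (s := √3) (k := 3*(4-√3)/13) (a := a/D) (b := b/D)
    (by positivity) (by norm_num) rfl (by positivity) (by gcongr) (by gcongr)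
    (by rw [← add_div, div_le_one hD]; exact hab) (by
      intro h1
      rw [lt_div_iff₀ hD] at h1
      obtain ⟨h1, h2, h3, h4, h5⟩ := H (by linarith)
      refine ⟨by positivity, ?_, ?_, by gcongr⟩
      · field_simp; linarith
      · field_simp; linarith)
  have e : (a^3/3 - (2 * (4 - √3) / 13 * D) * a^2/2) + (b^3/3 - (2 * (4 - √3) / 13 * D) * b^2/2)
     = D^3/3 * ((a/D)^3 - 3*(4-√3)/13*(a/D)^2 + ((b/D)^3 - 3*(4-√3)/13*(b/D)^2)) := by
    field_simp
  rw [e]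
  exact mul_nonpos_of_nonneg_of_nonpos (by positivity) this

lemma fw_center (Q : Set E2) (hQ : IsCompact Q) (hne : Q.Nonempty) :
    ∃ (p : E2) (R : ℝ), 0 ≤ R ∧ (∀ q ∈ Q, ‖q - p‖ ≤ R) ∧
      ∀ u : E2, ∃ q ∈ Q, ‖q - p‖ = R ∧ 0 ≤ inner ℝ (q - p) u := by
  set F : E2 → ℝ := fun p => sSup ((fun q => ‖q - p‖) '' Q) with hF
  have hcont : Continuous F := by
    apply hQ.continuous_sSup (f := fun (p q : E2) => ‖q - p‖)
    show Continuous (fun x : E2 × E2 => ‖x.2 - x.1‖)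
    fun_prop
  have hcq : ∀ p : E2, ContinuousOn (fun q : E2 => ‖q - p‖) Q := fun p => by fun_prop
  have hle : ∀ p, ∀ q ∈ Q, ‖q - p‖ ≤ F p := fun p q hq =>
    le_csSup (hQ.bddAbove_image (hcq p)) ⟨q, hq, rfl⟩
  obtain ⟨q0, hq0⟩ := hne
  have hlim : Filter.Tendsto F (Filter.cocompact E2) Filter.atTop := by
    refine Filter.tendsto_atTop_mono ?_ (tendsto_dist_left_cocompact_atTop q0)
    intro p
    rw [dist_eq_norm]
    exact hle p q0 hq0
  obtain ⟨p, hp⟩ := hcont.exists_forall_le hlim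
  refine ⟨p, F p, (norm_nonneg _).trans (hle p q0 hq0), hle p, fun u => ?_⟩
  have hatt : ∀ n : ℕ, ∃ q ∈ Q, F p ≤ ‖q - (p + (1/((n:ℝ)+1)) • (-u))‖ := by
    intro n
    obtain ⟨q, hq, h⟩ := hQ.exists_sSup_image_eq ⟨q0, hq0⟩ (hcq (p + (1/((n:ℝ)+1)) • (-u)))
    exact ⟨q, hq, h ▸ hp _⟩
  choose q hq hqF using hatt
  obtain ⟨z, hz, φ, hφ, hlimz⟩ := hQ.tendsto_subseq hq
  have heps : Filter.Tendsto (fun n => 1/(((φ n : ℕ):ℝ)+1)) Filter.atTop (nhds 0) :=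
    tendsto_one_div_add_atTop_nhds_zero_nat.comp hφ.tendsto_atTop
  have hFp : 0 ≤ F p := (norm_nonneg _).trans (hle p q0 hq0)
  have hexp : ∀ n, (F p)^2 ≤ ‖q (φ n) - p‖^2 + 2 * (1/(((φ n : ℕ):ℝ)+1)) * inner ℝ (q (φ n) - p) u
      + (1/(((φ n : ℕ):ℝ)+1))^2 * ‖u‖^2 := by
    intro n
    have h := pow_le_pow_left₀ hFp (hqF (φ n)) 2
    have e : q (φ n) - (p + (1/(((φ n : ℕ):ℝ)+1)) • (-u)) = (q (φ n) - p) + (1/(((φ n : ℕ):ℝ)+1)) • u := by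
      rw [smul_neg]; abel
    rw [e, norm_add_sq_real, inner_smul_right, norm_smul, mul_pow, Real.norm_eq_abs, sq_abs] at h
    linarith
  have hl2 : Filter.Tendsto (fun n => q (φ n) - p) Filter.atTop (nhds (z - p)) :=
    hlimz.sub_const p
  refine ⟨z, hz, le_antisymm (hle p z hz) ?_, ?_⟩
  · have : (F p)^2 ≤ ‖z - p‖^2 + 2 * 0 * inner ℝ (z - p) u + 0^2 * ‖u‖^2 := by
      refine ge_of_tendsto' (x := Filter.atTop) ?_ hexp
      exact (((hl2.norm.pow 2).add ((heps.const_mul 2).mul (hl2.inner tendsto_const_nhds))).add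
        ((heps.pow 2).mul_const _))
    exact abs_le_of_sq_le_sq' (by linarith) (norm_nonneg _) |>.2
  · have : 0 ≤ 2 * inner ℝ (z - p) u + 0 * ‖u‖^2 := by
      refine ge_of_tendsto' (((hl2.inner tendsto_const_nhds).const_mul 2).add (heps.mul_const _)) ?_
      intro n
      have h := hexp n
      have h2 := pow_le_pow_left₀ (norm_nonneg _) (hle p _ (hq (φ n))) 2
      have hpos : (0:ℝ) < 1/(((φ n : ℕ):ℝ)+1) := by positivity
      set ε := 1/(((φ n : ℕ):ℝ)+1)
      by_contra hcon
      push Not at hcon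
      nlinarith [mul_neg_of_pos_of_neg hpos hcon]
    linarith

lemma fw_dir (Q : Set E2) (p : E2) (R D h : ℝ) (hR : 0 ≤ R) (hD : 0 < D) (hh : 0 < h)
    (hRh : h^2 = R^2 - D^2/4)
    (hdist : ∀ x ∈ Q, ∀ y ∈ Q, dist x y ≤ D)
    (hact : ∀ u : E2, ∃ q ∈ Q, ‖q - p‖ = R ∧ 0 ≤ inner ℝ (q - p) u)
    (u : E2) (hu : ‖u‖ = 1) : ∃ q ∈ Q, ‖q - p‖ = R ∧ h ≤ inner ℝ (q - p) u := by
  by_contra hcon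
  push Not at hcon
  set v : E2 := !₂[-u 1, u 0] with hv
  have hu2 : u 0 ^2 + u 1 ^2 = 1 := by
    have := EuclideanSpace.norm_sq_eq u
    rw [hu] at this
    simp [Fin.sum_univ_two] at this
    linarith
  have hsq : ∀ y : E2, (inner ℝ y u)^2 + (inner ℝ y v)^2 = ‖y‖^2 := by
    intro y
    have := EuclideanSpace.norm_sq_eq y
    simp [Fin.sum_univ_two] at this
    rw [this]
    simp [PiLp.inner_apply, Fin.sum_univ_two, hv]
    linear_combination (y 0 ^2 + y 1^2) * hu2
  -- coordinates
  have hs : ∀ q ∈ Q, ∀ q' ∈ Q, inner ℝ (q - p) v - inner ℝ (q' - p) v ≤ D := by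
    intro q hq q' hq'
    have h1 := hdist q hq q' hq'
    rw [dist_eq_norm] at h1
    rw [← inner_sub_left, sub_sub_sub_cancel_right]
    have h2 := hsq (q - q')
    refine (abs_le_of_sq_le_sq' (?_ : _ ≤ D^2) hD.le).2
    have := pow_le_pow_left₀ (norm_nonneg _) h1 2
    nlinarith [sq_nonneg (inner ℝ (q - q') u)]
  have alg : ∀ s t : ℝ, s^2 + t^2 = R^2 → t < h → -(D/2) < s → t * (D/2) - h * s < 0 := by
    intro s t h1 h2 h3
    by_contra hc
    push Not at hc
    rcases le_or_gt 0 s with h4 | h4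
    · have ht : 0 ≤ t := by
        have : 0 ≤ h * s := by positivity
        by_contra hneg
        push Not at hneg
        nlinarith
      have hsD : s < D/2 := by
        by_contra hc2
        push Not at hc2
        nlinarith
      nlinarith
    · have ht : t < -h := by
        by_contra hc2
        push Not at hc2
        nlinarith
      nlinarith
  by_cases c1 : ∃ q ∈ Q, D/2 < inner ℝ (q - p) v
  · obtain ⟨i, hi, hiv⟩ := c1
    obtain ⟨q, hq, hqR, hq0⟩ := hact ((D/2) • u - h • v)
    rw [inner_sub_right, inner_smul_right, inner_smul_right] at hq0
    have := alg (inner ℝ (q - p) v) (inner ℝ (q - p) u) (by rw [← hqR, ← hsq]; ring)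
      (hcon q hq hqR) (by linarith [hs i hi q hq])
    linarith
  by_cases c2 : ∃ q ∈ Q, inner ℝ (q - p) v < -(D/2)
  · obtain ⟨i, hi, hiv⟩ := c2
    obtain ⟨q, hq, hqR, hq0⟩ := hact ((D/2) • u + h • v)
    rw [inner_add_right, inner_smul_right, inner_smul_right] at hq0
    have := alg (-inner ℝ (q - p) v) (inner ℝ (q - p) u) (by rw [← hqR, ← hsq]; ring)
      (hcon q hq hqR) (by linarith [hs q hq i hi])
    linarith
  push Not at c1 c2
  obtain ⟨q, hq, hqR, hq0⟩ := hact u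
  have h1 := hcon q hq hqR
  have h2 := hsq (q - p)
  rw [hqR] at h2
  nlinarith [c1 q hq, c2 q hq]

lemma fw_jung (Q : Set E2) (p : E2) (R D h : ℝ) (hD : 0 < D) (hh : 0 < h) (hR : 0 < R)
    (hRh : h^2 = R^2 - D^2/4)
    (hdist : ∀ x ∈ Q, ∀ y ∈ Q, dist x y ≤ D)
    (hact : ∀ u : E2, ∃ q ∈ Q, ‖q - p‖ = R ∧ 0 ≤ inner ℝ (q - p) u) : R^2 ≤ D^2/3 := by
  obtain ⟨q0, hq0, hq0R, -⟩ := hact 0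
  obtain ⟨q, hq, hqR, hqh⟩ := fw_dir Q p R D h hR.le hD hh hRh hdist hact (-(R⁻¹ • (q0 - p)))
    (by rw [norm_neg, norm_smul, hq0R, norm_inv, Real.norm_of_nonneg hR.le]; field_simp)
  rw [inner_neg_right, inner_smul_right] at hqh
  have h1 := pow_le_pow_left₀ dist_nonneg (hdist q hq q0 hq0) 2
  rw [dist_eq_norm, ← sub_sub_sub_cancel_right q q0 p, norm_sub_sq_real, hqR, hq0R] at h1
  have h2 : h * R ≤ - inner ℝ (q - p) (q0 - p) := by
    have := mul_le_mul_of_nonneg_right hqh hR.le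
    have e : -(R⁻¹ * inner ℝ (q - p) (q0 - p)) * R = - inner ℝ (q - p) (q0 - p) := by
      field_simp
    linarith
  have h3 : 2*(h*R) ≤ D^2 - 2*R^2 := by linarith
  have h4 : (2*(h*R))^2 ≤ (D^2 - 2*R^2)^2 := pow_le_pow_left₀ (by positivity) h3 2
  have h5 : (2*(h*R))^2 = 4*(R^2 - D^2/4)*R^2 := by rw [← hRh]; ring
  have h6 : 0 ≤ D^2 * (D^2/3 - R^2) := by nlinarith
  have := nonneg_of_mul_nonneg_right h6 (by positivity)
  linarith

lemma fw_sep (Q : Set E2) (hQ : IsCompact Q) (hc : Convex ℝ Q) (p : E2) (h : ℝ)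
    (H : ∀ w : E2, ∃ q ∈ Q, h * ‖w‖ ≤ inner ℝ (q - p) w)
    (x : E2) (hx : ‖x‖ ≤ h) : p + x ∈ Q := by
  by_contra hcon
  obtain ⟨f, c, hf1, hf2⟩ := geometric_hahn_banach_closed_point hc hQ.isClosed hcon
  obtain ⟨q, hq, hqw⟩ := H ((InnerProductSpace.toDual ℝ E2).symm f)
  have e : ∀ y, inner ℝ y ((InnerProductSpace.toDual ℝ E2).symm f) = f y := by
    intro y; rw [real_inner_comm]; exact InnerProductSpace.toDual_symm_apply
  have h1 := hf1 q hq
  have h2 : f x ≤ h * ‖(InnerProductSpace.toDual ℝ E2).symm f‖ := by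
    rw [← e]
    exact (real_inner_le_norm _ _).trans (by gcongr)
  rw [e, map_sub] at hqw
  rw [map_add] at hf2
  linarith

lemma fw_ray (K : Set E2) (hK : IsCompact K) (hc : Convex ℝ K) (h0 : (0:E2) ∈ K) (θ : E2) (hθ : ‖θ‖ = 1) :
    ∃ a : ℝ, 0 ≤ a ∧ ∀ r : ℝ, 0 ≤ r → (r • θ ∈ K ↔ r ≤ a) := by
  set S : Set ℝ := {r | r • θ ∈ K} ∩ Set.Ici 0 with hS
  have hScl : IsClosed S := (hK.isClosed.preimage (by fun_prop)).inter isClosed_Ici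
  have hS0 : (0:ℝ) ∈ S := by simp [hS, h0]
  obtain ⟨M, hM⟩ := hK.isBounded.exists_norm_le
  have hSb : BddAbove S := by
    refine ⟨M, fun r hr => ?_⟩
    have := hM _ hr.1
    rw [norm_smul, hθ, mul_one] at this
    exact (le_abs_self r).trans this
  have hmem : sSup S ∈ S := hScl.csSup_mem ⟨0, hS0⟩ hSb
  refine ⟨sSup S, le_csSup hSb hS0, fun r hr => ⟨fun h => le_csSup hSb ⟨h, hr⟩, fun h => ?_⟩⟩
  rcases hr.eq_or_lt with rfl | hr
  · simpa using h0
  have hpos : 0 < sSup S := hr.trans_le h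
  have := hc.smul_mem_of_zero_mem h0 hmem.1 (t := r / sSup S) ⟨by positivity, by rwa [div_le_one hpos]⟩
  rw [smul_smul] at this
  rwa [div_mul_cancel₀ _ hpos.ne'] at this

lemma fw_rad (C a : ℝ) (ha : 0 ≤ a) :
    ∫ r in Set.Ioi (0:ℝ), (Set.Ioc 0 a).indicator (fun r => r * (r - C)) r = a^3/3 - C*a^2/2 := by
  rw [setIntegral_indicator measurableSet_Ioc, Set.inter_eq_self_of_subset_right (fun x hx => hx.1),
    ← intervalIntegral.integral_of_le ha]
  have : ∀ r : ℝ, r*(r-C) = r^2 - C*r := fun r => by ring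
  simp_rw [this]
  rw [intervalIntegral.integral_sub (Continuous.intervalIntegrable (by fun_prop) _ _) (Continuous.intervalIntegrable (by fun_prop) _ _), intervalIntegral.integral_const_mul]
  simp
  ring

lemma fw_int (K : Set E2) (hK : IsCompact K) (hc : Convex ℝ K) (h0 : (0:E2) ∈ K) (C : ℝ)
    (H : ∀ θ : E2, ‖θ‖ = 1 → ∀ a b : ℝ, 0 ≤ a → 0 ≤ b → a • θ ∈ K → b • (-θ) ∈ K →
      (∀ r : ℝ, 0 ≤ r → r • θ ∈ K → r ≤ a) → (∀ r : ℝ, 0 ≤ r → r • (-θ) ∈ K → r ≤ b) →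
      (a^3/3 - C*a^2/2) + (b^3/3 - C*b^2/2) ≤ 0) :
    ∫ x in K, (‖x‖ - C) ≤ 0 := by
  set g : E2 → ℝ := K.indicator (fun x => ‖x‖ - C) with hg
  have hgi : Integrable g := by
    rw [hg, integrable_indicator_iff hK.measurableSet]
    exact ContinuousOn.integrableOn_compact hK (by fun_prop)
  have hgn : Integrable (fun x => g (-x)) := hgi.comp_neg
  set G : E2 → ℝ := fun x => g x + g (-x) with hG
  have hGi : Integrable G := hgi.add hgn
  have e1 : ∫ x, G x = 2 * ∫ x in K, (‖x‖ - C) := by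
    rw [hG, integral_add hgi hgn, integral_neg_eq_self g, hg, integral_indicator hK.measurableSet]
    ring
  suffices ∫ x, G x ≤ 0 by linarith
  have mp := (volume : Measure E2).measurePreserving_homeomorphUnitSphereProd
  have me : MeasurableEmbedding (homeomorphUnitSphereProd E2) := Homeomorph.measurableEmbedding _
  set P : (sphere (0:E2) 1) × (Set.Ioi (0:ℝ)) → ℝ := fun z => G (z.2.1 • z.1.1) with hP
  have hcomp : ∀ x : ({0}ᶜ : Set E2), P (homeomorphUnitSphereProd E2 x) = G x.1 := by
    intro x
    rw [hP]
    simp only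
    congr 1
    have := homeomorphUnitSphereProd_symm_apply_coe E2 (homeomorphUnitSphereProd E2 x)
    rw [Homeomorph.symm_apply_apply] at this
    exact this.symm
  have e2 : ∫ x, G x = ∫ z, P z ∂((volume : Measure E2).toSphere.prod (.volumeIoiPow (Module.finrank ℝ E2 - 1))) := by
    rw [← mp.integral_comp me]
    simp_rw [hcomp]
    rw [integral_subtype_comap (measurableSet_singleton _).compl G, restrict_compl_singleton]
  have hPi : Integrable P ((volume : Measure E2).toSphere.prod (.volumeIoiPow (Module.finrank ℝ E2 - 1))) := by
    rw [← mp.integrable_comp_emb me]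
    have : P ∘ (homeomorphUnitSphereProd E2) = G ∘ Subtype.val := funext hcomp
    rw [this, ← integrableOn_iff_comap_subtypeVal (measurableSet_singleton _).compl]
    exact hGi.integrableOn
  rw [e2, integral_prod _ hPi]
  refine integral_nonpos fun θ => ?_
  have hθ : ‖θ.1‖ = 1 := by simpa using θ.2
  obtain ⟨a, ha, hA⟩ := fw_ray K hK hc h0 θ.1 hθ
  obtain ⟨b, hb, hB⟩ := fw_ray K hK hc h0 (-θ.1) (by simpa using hθ)
  have hfin : Module.finrank ℝ E2 - 1 = 1 := by simp
  simp only [hfin, Pi.zero_apply]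
  have hev : ∀ r : ℝ, 0 < r → r * G (r • θ.1) =
      (Set.Ioc 0 a).indicator (fun r => r * (r - C)) r + (Set.Ioc 0 b).indicator (fun r => r * (r - C)) r := by
    intro r hr
    have hA' := hA r hr.le
    have hB' := hB r hr.le
    rw [smul_neg] at hB'
    have hn : ‖r • θ.1‖ = r := by rw [norm_smul, hθ, mul_one, Real.norm_of_nonneg hr.le]
    have h1 : g (r • θ.1) = (Set.Ioc 0 a).indicator (fun r => r - C) r := by
      by_cases h : r ≤ a
      · rw [Set.indicator_of_mem (show r ∈ Set.Ioc 0 a from ⟨hr, h⟩), hg,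
          Set.indicator_of_mem (hA'.2 h), hn]
      · rw [Set.indicator_of_notMem (fun hh => h hh.2), hg,
          Set.indicator_of_notMem (fun hh => h (hA'.1 hh))]
    have h2 : g (-(r • θ.1)) = (Set.Ioc 0 b).indicator (fun r => r - C) r := by
      by_cases h : r ≤ b
      · rw [Set.indicator_of_mem (show r ∈ Set.Ioc 0 b from ⟨hr, h⟩), hg,
          Set.indicator_of_mem (hB'.2 h), norm_neg, hn]
      · rw [Set.indicator_of_notMem (fun hh => h hh.2), hg,
          Set.indicator_of_notMem (fun hh => h (hB'.1 hh))]
    show r * (g (r • θ.1) + g (-(r • θ.1))) = _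
    rw [h1, h2, mul_add]
    simp only [Set.indicator_apply, mul_ite, mul_zero]
  have e3 : ∫ r : Set.Ioi (0:ℝ), P (θ, r) ∂(Measure.volumeIoiPow 1) =
      ∫ r in Set.Ioi (0:ℝ), r * G (r • θ.1) := by
    simp only [Measure.volumeIoiPow, ENNReal.ofReal]
    rw [integral_withDensity_eq_integral_smul,
        integral_subtype_comap measurableSet_Ioi fun r ↦ Real.toNNReal (r ^ 1) • G (r • θ.1),
        setIntegral_congr_fun measurableSet_Ioi fun x hx ↦ ?_]
    · simp only [NNReal.smul_def, pow_one]
      rw [Real.coe_toNNReal _ (le_of_lt hx), smul_eq_mul]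
    · exact (measurable_subtype_coe.pow_const _).real_toNNReal
  have hii : ∀ a : ℝ, Integrable ((Set.Ioc 0 a).indicator (fun r => r * (r - C))) (volume.restrict (Set.Ioi 0)) := by
    intro a
    apply Integrable.restrict
    rw [integrable_indicator_iff measurableSet_Ioc]
    exact (Continuous.integrableOn_Icc (by fun_prop)).mono_set Set.Ioc_subset_Icc_self
  rw [e3, setIntegral_congr_fun measurableSet_Ioi (fun r hr => hev r hr), integral_add (hii a) (hii b),
    fw_rad C a ha, fw_rad C b hb]
  exact H θ.1 hθ a b ha hb ((hA a ha).2 le_rfl) ((hB b hb).2 le_rfl)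
    (fun r hr => (hA r hr).1) (fun r hr => (hB r hr).1)

/-- For every convex body `Q` in the plane,
`μ*_Q ≤ (2(4−√3)/13)·Δ(Q)`. -/
theorem fermat_weber_upper_bound (Q : Set (EuclideanSpace ℝ (Fin 2)))
    (hQc : IsCompact Q) (hQconv : Convex ℝ Q) (hQint : (interior Q).Nonempty) :
    (⨅ p : EuclideanSpace ℝ (Fin 2), (∫ q in Q, dist p q) / (volume Q).toReal) ≤
      2 * (4 - Real.sqrt 3) / 13 * Metric.diam Q := by
  have hne : Q.Nonempty := hQint.mono interior_subset
  have hvol : 0 < (volume Q).toReal := ENNReal.toReal_pos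
    (Measure.measure_pos_of_nonempty_interior _ hQint).ne' hQc.measure_lt_top.ne
  obtain ⟨p, R, hR0, hball, hact⟩ := fw_center Q hQc hne
  set D := Metric.diam Q with hDdef
  have hdist : ∀ x ∈ Q, ∀ y ∈ Q, dist x y ≤ D := fun x hx y hy =>
    dist_le_diam_of_mem hQc.isBounded hx hy
  have hD : 0 < D := by
    apply Metric.diam_pos _ hQc.isBounded
    by_contra hcon
    rw [Set.not_nontrivial_iff] at hcon
    rw [hcon.measure_zero] at hvol
    simp at hvol
  have hpQ : p ∈ Q := by
    have := fw_sep Q hQc hQconv p 0 (fun w => by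
      obtain ⟨q, hq, -, h⟩ := hact w
      exact ⟨q, hq, by simpa using h⟩) 0 (by simp)
    simpa using this
  set h := √(R^2 - D^2/4) with hh
  have key : D/2 < R → 0 < h ∧ h^2 = R^2 - D^2/4 ∧ R^2 ≤ D^2/3 ∧ ∀ x : E2, ‖x‖ ≤ h → p + x ∈ Q := by
    intro hRD
    have h1 : 0 < R^2 - D^2/4 := by nlinarith
    have hpos : 0 < h := Real.sqrt_pos.2 h1
    have hsq : h^2 = R^2 - D^2/4 := Real.sq_sqrt h1.le
    refine ⟨hpos, hsq, fw_jung Q p R D h hD hpos (by linarith) hsq hdist hact,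
      fw_sep Q hQc hQconv p h fun w => ?_⟩
    by_cases hw : w = 0
    · exact ⟨p, hpQ, by simp [hw]⟩
    have hw' : 0 < ‖w‖ := norm_pos_iff.2 hw
    obtain ⟨q, hq, -, hq2⟩ := fw_dir Q p R D h hR0 hD hpos hsq hdist hact (‖w‖⁻¹ • w)
      (by rw [norm_smul, norm_inv, norm_norm, inv_mul_cancel₀ hw'.ne'])
    refine ⟨q, hq, ?_⟩
    rw [inner_smul_right] at hq2
    have := mul_le_mul_of_nonneg_right hq2 hw'.le
    rwa [mul_comm ‖w‖⁻¹, mul_assoc, inv_mul_cancel₀ hw'.ne', mul_one] at this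
  set C := 2 * (4 - √3) / 13 * D with hC
  set K : Set E2 := (fun x => p + x) ⁻¹' Q with hKdef
  have hKc : IsCompact K := (Homeomorph.addLeft p).isClosedEmbedding.isCompact_preimage hQc
  have hKconv : Convex ℝ K := hQconv.translate_preimage_right p
  have hK0 : (0:E2) ∈ K := by simpa [hKdef] using hpQ
  have hint := fw_int K hKc hKconv hK0 C (by
    intro θ hθ a b ha hb haK hbK hA hB
    have e1 : ‖a • θ‖ = a := by rw [norm_smul, hθ, mul_one, Real.norm_of_nonneg ha]
    have e2 : ‖b • (-θ)‖ = b := by rw [norm_smul, norm_neg, hθ, mul_one, Real.norm_of_nonneg hb]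
    apply fw_ineq (R := R) (h := h) hD ha hb
    · have := hball _ haK
      rwa [add_sub_cancel_left, e1] at this
    · have := hball _ hbK
      rwa [add_sub_cancel_left, e2] at this
    · have := hdist _ haK _ hbK
      rw [dist_eq_norm, add_sub_add_left_eq_sub, smul_neg, sub_neg_eq_add, ← add_smul, norm_smul, hθ,
        mul_one, Real.norm_of_nonneg (by positivity)] at this
      exact this
    · intro hRD
      obtain ⟨h1, h2, h3, h4⟩ := key hRD
      refine ⟨h1.le, h2, h3, hA h h1.le (h4 _ ?_), hB h h1.le (h4 _ ?_)⟩
      · rw [norm_smul, hθ, mul_one, Real.norm_of_nonneg h1.le]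
      · rw [norm_smul, norm_neg, hθ, mul_one, Real.norm_of_nonneg h1.le])
  have htrans : ∫ x in K, (‖x‖ - C) = ∫ q in Q, (dist p q - C) := by
    have := (measurePreserving_add_left (volume : Measure E2) p).setIntegral_preimage_emb
      (measurableEmbedding_addLeft p) (fun q => dist p q - C) Q
    rw [← this]
    simp [hKdef, dist_eq_norm]
  have hi : IntegrableOn (fun q => dist p q) Q := ContinuousOn.integrableOn_compact hQc (by fun_prop)
  rw [htrans, integral_sub hi (integrableOn_const hQc.measure_lt_top.ne), setIntegral_const, smul_eq_mul] at hint
  refine (ciInf_le ⟨0, ?_⟩ p).trans ?_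
  · rintro _ ⟨x, rfl⟩
    exact div_nonneg (integral_nonneg fun _ => dist_nonneg) ENNReal.toReal_nonneg
  · rw [div_le_iff₀ hvol]
    rw [Measure.real] at hint
    linarith
end
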